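/- Main rounding guarantee: let C, D be edge weights on a finite set V with Laplacians L_C, L_D, let r be a positive integer with r + 1 ≤ rank(L_D), let ε > 0, and set r' = ⌈r/ε⌉ + r − 1. Let x ∈ Lasserre_{2r'+2}(V) be any Lasserre solution with Σ_{u<v} D_{u,v}‖x_u − x_v‖² > 0, and write Φ^SDP = (Σ_{u<v} C_{u,v}‖x_u − x_v‖²)/(Σ_{u<v} D_{u,v}‖x_u − x_v‖²). If (1+ε)·Φ^SDP/λ_{r+1}(L_C, L_D) < 1, then there exists a subset T ⊆ V with D(T) > 0 whose sparsity satisfies Φ_T ≤ Φ^SDP · (1 − (1+ε)·Φ^SDP/λ_{r+1}(L_C, L_D))^{−1}. -/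

import Mathlib

open scoped RealInnerProductSpace

/-- Extend a labeling of the subset `N` to all of `V` by assigning `false` outside `N`. -/
def extendLab {V : Type*} [DecidableEq V] (N : Finset V) (g : {a // a ∈ N} → Bool) :
    V → Bool :=
  fun v => if h : v ∈ N then g ⟨v, h⟩ else false

/-- `x` satisfies `r` rounds of the Lasserre hierarchy (for 0/1 labelings of `V`),
with vectors in `ℝ^d`.  A collection is encoded as a function on all finite subsets `S`
and all full labelings `f : V → Bool`, where `x S f` may depend only on the restriction
of `f` to `S`. -/
structure IsLasserre (V : Type*) [Fintype V] [DecidableEq V] (r d : ℕ)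
    (x : Finset V → (V → Bool) → EuclideanSpace ℝ (Fin d)) : Prop where
  /-- `x S f` depends only on the labels of the vertices in `S`. -/
  localDep : ∀ S : Finset V, ∀ f g : V → Bool, (∀ u ∈ S, f u = g u) → x S f = x S g
  /-- (a) `x_∅ ≠ 0`. -/
  nonzero : x ∅ (fun _ => false) ≠ 0
  /-- (b) orthogonality of inconsistent labelings. -/
  ortho : ∀ S T : Finset V, S.card ≤ r + 1 → T.card ≤ r + 1 →
    ∀ f g : V → Bool, (∃ u ∈ S ∩ T, f u ≠ g u) → ⟪x S f, x T g⟫ = 0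
  /-- (c) consistency: the inner product depends only on `S ∪ T` and the combined labeling. -/
  consistent : ∀ S T A B : Finset V, S.card ≤ r + 1 → T.card ≤ r + 1 →
    A.card ≤ r + 1 → B.card ≤ r + 1 → S ∪ T = A ∪ B →
    ∀ h : V → Bool, ⟪x S h, x T h⟫ = ⟪x A h, x B h⟫
  /-- (d) for each vertex the label probabilities sum to `‖x_∅‖²`. -/
  unitTotal : ∀ u : V,
    ‖x {u} (fun _ => false)‖ ^ 2 + ‖x {u} (fun _ => true)‖ ^ 2
      = ‖x ∅ (fun _ => false)‖ ^ 2
  /-- (e) marginalization over the label of one vertex. -/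
  marginal : ∀ S : Finset V, S.card ≤ r + 1 → ∀ u ∈ S, ∀ f : V → Bool,
    x S (Function.update f u false) + x S (Function.update f u true) = x (S.erase u) f

/-- The vector `x_u = x_{{u}}(1)` associated with a single vertex. -/
def xVec {V : Type*} [Fintype V] [DecidableEq V] {d : ℕ}
    (x : Finset V → (V → Bool) → EuclideanSpace ℝ (Fin d)) (u : V) :
    EuclideanSpace ℝ (Fin d) :=
  x {u} (fun _ => true)


/-- The demand/cost-weighted sum `Σ_{u<v} W_{u,v} ‖x_u − x_v‖²`,
computed as half of the symmetric double sum. -/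
noncomputable def edgeSum {V : Type*} [Fintype V] [DecidableEq V] {d : ℕ} (W : V → V → ℝ)
    (x : Finset V → (V → Bool) → EuclideanSpace ℝ (Fin d)) : ℝ :=
  (∑ u : V, ∑ v : V, W u v * ‖xVec x u - xVec x v‖ ^ 2) / 2

open scoped Matrix

/-- Weight of edges crossing the cut `(T, V∖T)`:
`Σ_{u<v} W_{u,v} |1_T(u) − 1_T(v)|`, computed as half of the symmetric double sum. -/
noncomputable def cutVal {V : Type*} [Fintype V] [DecidableEq V]
    (W : V → V → ℝ) (T : Finset V) : ℝ :=
  (∑ u : V, ∑ v : V, W u v *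
    |(if u ∈ T then (1 : ℝ) else 0) - (if v ∈ T then (1 : ℝ) else 0)|) / 2

/-- The Laplacian matrix of the edge weights `W`. -/
noncomputable def lapM {V : Type*} [Fintype V] [DecidableEq V] (W : V → V → ℝ) :
    Matrix V V ℝ :=
  Matrix.of fun a b =>
    if a = b then ∑ c ∈ Finset.univ.filter (fun c => c ≠ a), W a c else - W a b

/-- The `i`-th smallest generalized eigenvalue `λ_i(X, Y)`. -/
noncomputable def genEig {n : Type*} [Fintype n] (X Y : Matrix n n ℝ) (i : ℕ) : ℝ :=
  ⨆ Z : {Z : Submodule ℝ (n → ℝ) // Module.finrank ℝ Z ≤ i - 1},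
    ⨅ w : {w : n → ℝ // (∀ z ∈ Z.1, w ⬝ᵥ z = 0) ∧ Y.mulVec w ≠ 0},
      (w.1 ⬝ᵥ X.mulVec w.1) / (w.1 ⬝ᵥ Y.mulVec w.1)

/-- Adjoining a vector multiplies a Gram determinant by the squared distance to the span. -/
theorem det_gram_cons {H : Type*} [NormedAddCommGroup H] [InnerProductSpace ℝ H] {n : ℕ}
    (s : Fin n → H) (e p : H) (hp : p ∈ Submodule.span ℝ (Set.range s))
    (horth : ∀ i, ⟪e - p, s i⟫ = 0) :
    (Matrix.gram ℝ (Fin.cons e s : Fin (n + 1) → H)).det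
      = ‖e - p‖ ^ 2 * (Matrix.gram ℝ s).det := by
  obtain ⟨c, hc⟩ := (Submodule.mem_span_range_iff_exists_fun ℝ).1 hp
  have hpe : ⟪e - p, p⟫ = 0 := by
    rw [← hc, inner_sum]
    exact Finset.sum_eq_zero fun i _ => by rw [inner_smul_right, hc, horth i, mul_zero]
  set M := Matrix.gram ℝ (Fin.cons e s : Fin (n + 1) → H) with hM
  have hrow : M = M.updateRow 0 ((fun j => ⟪e - p, (Fin.cons e s : Fin (n + 1) → H) j⟫) +
      ∑ k, (Fin.cons 0 c : Fin (n + 1) → ℝ) k • M k) := by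
    ext i j
    refine Fin.cases ?_ (fun i => ?_) i
    · simp only [Matrix.updateRow_self, Pi.add_apply, Finset.sum_apply, Pi.smul_apply,
        Fin.sum_univ_succ, Fin.cons_zero, Fin.cons_succ, zero_smul, zero_add, smul_eq_mul, hM,
        Matrix.gram_apply]
      rw [inner_sub_left, ← hc, sum_inner]
      simp [inner_smul_left]
    · rw [Matrix.updateRow_ne (Fin.succ_ne_zero i)]
  rw [hrow, Matrix.det_updateRow_add, Matrix.det_updateRow_sum, Matrix.det_succ_row_zero,
    Fin.sum_univ_succ]
  have h0 : ⟪e - p, e⟫ = ‖e - p‖ ^ 2 := by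
    rw [← real_inner_self_eq_norm_sq, inner_sub_right (e - p) e p, hpe, sub_zero]
  have hsub : (M.updateRow 0 (fun j => ⟪e - p, (Fin.cons e s : Fin (n + 1) → H) j⟫)).submatrix
      Fin.succ (Fin.succAbove 0) = Matrix.gram ℝ s := by
    ext i j
    simp [hM, Matrix.updateRow_apply, Fin.succ_ne_zero]
  rw [hsub]
  simp [horth, h0]

theorem det_gram_nonneg {H : Type*} [NormedAddCommGroup H] [InnerProductSpace ℝ H] {n : ℕ}
    (s : Fin n → H) : 0 ≤ (Matrix.gram ℝ s).det :=
  (Matrix.posSemidef_gram ℝ s).det_nonneg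

theorem det_gram_cons_starProjection {H : Type*} [NormedAddCommGroup H] [InnerProductSpace ℝ H]
    [FiniteDimensional ℝ H] {n : ℕ} (s : Fin n → H) (e : H) :
    (Matrix.gram ℝ (Fin.cons e s : Fin (n + 1) → H)).det
      = ‖e - (Submodule.span ℝ (Set.range s)).starProjection e‖ ^ 2 * (Matrix.gram ℝ s).det :=
  det_gram_cons s e _ (Submodule.starProjection_apply_mem _ _) fun i => by
    have h := Submodule.sub_starProjection_mem_orthogonal
      (K := Submodule.span ℝ (Set.range s)) e
    exact (Submodule.mem_orthogonal' _ _).1 h _ (Submodule.subset_span ⟨i, rfl⟩)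

theorem det_gram_cons_le {H : Type*} [NormedAddCommGroup H] [InnerProductSpace ℝ H]
    [FiniteDimensional ℝ H] {n : ℕ}
    (s : Fin n → H) (e : H) :
    (Matrix.gram ℝ (Fin.cons e s : Fin (n + 1) → H)).det ≤ ‖e‖ ^ 2 * (Matrix.gram ℝ s).det := by
  rw [det_gram_cons_starProjection]
  refine mul_le_mul_of_nonneg_right ?_ (det_gram_nonneg s)
  rw [← Submodule.starProjection_orthogonal_val]
  exact pow_le_pow_left₀ (norm_nonneg _) (Submodule.norm_starProjection_apply_le _ _) 2

/-- A Cauchy–Binet identity: the principal minors of `A Aᵀ` and `Aᵀ A`, summed over tuples of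
indices, have the same total. -/
theorem sum_det_submatrix_mul_transpose {ι E : Type*} [Fintype ι] [Fintype E]
    (A : Matrix ι E ℝ) (n : ℕ) :
    ∑ s : Fin n → E, ((Aᵀ * A).submatrix s s).det
      = ∑ t : Fin n → ι, ((A * Aᵀ).submatrix t t).det := by
  classical
  simp only [Matrix.det_apply, Matrix.submatrix_apply, Matrix.mul_apply, Matrix.transpose_apply]
  simp only [Finset.prod_univ_sum, Fintype.piFinset_univ, Finset.smul_sum]
  rw [Finset.sum_comm]
  conv_rhs => rw [Finset.sum_comm]
  rw [← Equiv.sum_comp (Equiv.inv (Equiv.Perm (Fin n)))]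
  refine Finset.sum_congr rfl fun σ _ => ?_
  rw [Finset.sum_comm]
  refine Finset.sum_congr rfl fun t _ => Finset.sum_congr rfl fun s _ => ?_
  simp only [Equiv.inv_apply, Equiv.Perm.sign_inv]
  congr 1
  rw [Finset.prod_mul_distrib, Finset.prod_mul_distrib,
    ← Equiv.prod_comp σ (fun i => A (t i) (s (σ⁻¹ i)))]
  simp [mul_comm]

theorem det_gram_comp_perm {H : Type*} [NormedAddCommGroup H] [InnerProductSpace ℝ H] {n : ℕ}
    (s : Fin n → H) (σ : Equiv.Perm (Fin n)) :
    (Matrix.gram ℝ (s ∘ σ)).det = (Matrix.gram ℝ s).det :=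
  Matrix.det_submatrix_equiv_self σ (Matrix.gram ℝ s)

theorem sum_det_gram_succ {ι H : Type*} [Fintype ι] [NormedAddCommGroup H]
    [InnerProductSpace ℝ H] [FiniteDimensional ℝ H] {n : ℕ} (R : ι → H) (w : ι → ℝ) :
    ∑ t : Fin (n + 1) → ι, w (t 0) * (Matrix.gram ℝ (R ∘ t)).det
      = ∑ q : ι, ∑ t : Fin n → ι,
        w q * (Matrix.gram ℝ (Fin.cons (R q) (R ∘ t) : Fin (n + 1) → H)).det := by
  rw [← Equiv.sum_comp (Fin.consEquiv fun _ => ι), Fintype.sum_prod_type]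
  refine Finset.sum_congr rfl fun q _ => Finset.sum_congr rfl fun t _ => ?_
  have : R ∘ (Fin.cons q t : Fin (n + 1) → ι) = Fin.cons (R q) (R ∘ t) := by
    ext i; refine Fin.cases ?_ (fun i => ?_) i <;> simp
  simp [Fin.consEquiv, this]

/-- Sums of Gram determinants of `(n+1)`-tuples are controlled by those of `n`-tuples, ignoring the
norms of at most `r` exceptional vectors. -/
theorem sum_det_gram_le {ι H : Type*} [Fintype ι] [DecidableEq ι] [NormedAddCommGroup H]
    [InnerProductSpace ℝ H] [FiniteDimensional ℝ H] (R : ι → H) (top : Finset ι) (r n : ℕ) (htop : top.card ≤ r) :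
    ((n : ℝ) + 1 - r) * ∑ t : Fin (n + 1) → ι, (Matrix.gram ℝ (R ∘ t)).det
      ≤ (n + 1) * ((∑ q ∈ topᶜ, ‖R q‖ ^ 2) * ∑ t : Fin n → ι, (Matrix.gram ℝ (R ∘ t)).det) := by
  set w : ι → ℝ := fun q => if q ∈ topᶜ then 1 else 0 with hw
  have h1 : ∑ t : Fin (n + 1) → ι, w (t 0) * (Matrix.gram ℝ (R ∘ t)).det
      ≤ (∑ q ∈ topᶜ, ‖R q‖ ^ 2) * ∑ t : Fin n → ι, (Matrix.gram ℝ (R ∘ t)).det := by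
    rw [sum_det_gram_succ, Finset.sum_mul, ← Finset.sum_filter_add_sum_filter_not _ (· ∈ topᶜ)]
    have hz : ∑ q with q ∉ topᶜ, ∑ t : Fin n → ι,
        w q * (Matrix.gram ℝ (Fin.cons (R q) (R ∘ t) : Fin (n + 1) → H)).det = 0 := by
      refine Finset.sum_eq_zero fun q hq => Finset.sum_eq_zero fun t _ => ?_
      rw [hw]; simp only [(Finset.mem_filter.1 hq).2, if_false, zero_mul]
    rw [hz, add_zero, Finset.filter_mem_eq_inter, Finset.univ_inter]
    refine Finset.sum_le_sum fun q hq => ?_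
    rw [Finset.mul_sum]
    refine Finset.sum_le_sum fun t _ => ?_
    simp only [hw, hq, if_true, one_mul]
    exact det_gram_cons_le _ _
  have h2 : ∀ i : Fin (n + 1), ∑ t : Fin (n + 1) → ι, w (t i) * (Matrix.gram ℝ (R ∘ t)).det
      = ∑ t : Fin (n + 1) → ι, w (t 0) * (Matrix.gram ℝ (R ∘ t)).det := by
    intro i
    rw [← Equiv.sum_comp ((Equiv.swap 0 i).arrowCongr (Equiv.refl ι))]
    refine Finset.sum_congr rfl fun t _ => ?_
    have : R ∘ ((Equiv.swap 0 i).arrowCongr (Equiv.refl ι)) t = (R ∘ t) ∘ (Equiv.swap 0 i) := by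
      ext j; simp [Equiv.arrowCongr]
    rw [this, det_gram_comp_perm]
    simp [Equiv.arrowCongr]
  have h3 : ∀ t : Fin (n + 1) → ι, ((n : ℝ) + 1 - r) * (Matrix.gram ℝ (R ∘ t)).det
      ≤ ∑ i, w (t i) * (Matrix.gram ℝ (R ∘ t)).det := by
    intro t
    by_cases ht : Function.Injective t
    · rw [← Finset.sum_mul]
      refine mul_le_mul_of_nonneg_right ?_ (det_gram_nonneg _)
      have hc : (Finset.univ.filter fun i => t i ∈ top).card ≤ r :=
        (Finset.card_le_card_of_injOn t (fun i hi => by simpa using hi) ht.injOn).trans htop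
      have hs : ∑ i, w (t i) = (n : ℝ) + 1 - (Finset.univ.filter fun i => t i ∈ top).card := by
        have : ∀ i, w (t i) = 1 - (if t i ∈ top then (1 : ℝ) else 0) := by
          intro i
          by_cases h : t i ∈ top <;> simp [hw, h]
        simp only [this, Finset.sum_sub_distrib, Finset.sum_boole]
        simp
      rw [hs]
      have : ((Finset.univ.filter fun i => t i ∈ top).card : ℝ) ≤ r := by exact_mod_cast hc
      linarith
    · have : (Matrix.gram ℝ (R ∘ t)).det = 0 := by
        by_contra h
        exact ht (Matrix.linearIndependent_of_det_gram_ne_zero h).injective.of_comp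
      simp [this]
  calc _ = ∑ t : Fin (n + 1) → ι, ((n : ℝ) + 1 - r) * (Matrix.gram ℝ (R ∘ t)).det :=
        Finset.mul_sum _ _ _
    _ ≤ ∑ t : Fin (n + 1) → ι, ∑ i, w (t i) * (Matrix.gram ℝ (R ∘ t)).det :=
        Finset.sum_le_sum fun t _ => h3 t
    _ = ∑ i : Fin (n + 1), ∑ t : Fin (n + 1) → ι, w (t i) * (Matrix.gram ℝ (R ∘ t)).det :=
        Finset.sum_comm
    _ = (n + 1) * ∑ t : Fin (n + 1) → ι, w (t 0) * (Matrix.gram ℝ (R ∘ t)).det := by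
        simp [h2]
    _ ≤ _ := mul_le_mul_of_nonneg_left h1 (by positivity)

/-- Column-based low-rank reconstruction: among vectors `a e`, some `k + r - 1` of them span a
subspace whose squared residual is at most `(k + r) / k` times the residual left by any `r`
directions of an orthonormal basis. -/
theorem exists_columns_residual_le {ι E H : Type*} [Fintype ι] [DecidableEq ι] [Fintype E]
    [NormedAddCommGroup H] [InnerProductSpace ℝ H] [FiniteDimensional ℝ H] (b : OrthonormalBasis ι ℝ H) (a : E → H)
    (top : Finset ι) (r k m : ℕ) (htop : top.card ≤ r) (hm : m + 1 = k + r) :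
    ∃ n ≤ m, ∃ s : Fin n → E,
      k * ∑ e, ‖a e - (Submodule.span ℝ (Set.range (a ∘ s))).starProjection (a e)‖ ^ 2
        ≤ (k + r) * ∑ q ∈ topᶜ, ∑ e, ⟪b q, a e⟫ ^ 2 := by
  by_contra! hcon
  set η := ∑ q ∈ topᶜ, ∑ e, ⟪b q, a e⟫ ^ 2 with hη
  have hη0 : 0 ≤ η := Finset.sum_nonneg fun q _ => Finset.sum_nonneg fun e _ => sq_nonneg _
  set res : ∀ n, (Fin n → E) → ℝ := fun n s =>
    ∑ e, ‖a e - (Submodule.span ℝ (Set.range (a ∘ s))).starProjection (a e)‖ ^ 2 with hres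
  set W : ℕ → ℝ := fun n => ∑ s : Fin n → E, (Matrix.gram ℝ (a ∘ s)).det with hW
  have hWsucc : ∀ n, W (n + 1) = ∑ s : Fin n → E, res n s * (Matrix.gram ℝ (a ∘ s)).det := by
    intro n
    have := sum_det_gram_succ (n := n) a (fun _ => (1 : ℝ))
    simp only [one_mul] at this
    simp only [hW, this, hres, Finset.sum_mul]
    rw [Finset.sum_comm]
    simp only [det_gram_cons_starProjection]
  have hstep : ∀ n ≤ m, 0 < W n → (k + r) * η * W n < k * W (n + 1) := by
    intro n hn hpos
    rw [hWsucc, hW]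
    simp only [Finset.mul_sum]
    have hex : ∃ s : Fin n → E, 0 < (Matrix.gram ℝ (a ∘ s)).det := by
      by_contra! h
      exact absurd hpos (not_lt.2 (Finset.sum_nonpos fun s _ => h s))
    obtain ⟨s₀, hs₀⟩ := hex
    refine Finset.sum_lt_sum (fun s _ => ?_) ⟨s₀, Finset.mem_univ _, ?_⟩
    · rw [← mul_assoc]
      exact mul_le_mul_of_nonneg_right (hcon n hn s).le (det_gram_nonneg _)
    · rw [← mul_assoc]
      exact mul_lt_mul_of_pos_right (hcon n hn s₀) hs₀
  have hk0 : (0 : ℝ) ≤ k := Nat.cast_nonneg k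
  have hWpos : ∀ n ≤ m, 0 < W n := by
    intro n
    induction n with
    | zero => intro _; simp [hW]
    | succ n ih =>
      intro hn
      have hp := ih (by omega)
      have h1 := hstep n (by omega) hp
      have h2 : 0 ≤ (k + r) * η * W n := by positivity
      exact pos_of_mul_pos_right (h2.trans_lt h1) hk0
  have hlast := hstep m le_rfl (hWpos m le_rfl)
  set A : Matrix ι E ℝ := Matrix.of fun q e => ⟪b q, a e⟫ with hA
  set R : ι → EuclideanSpace ℝ E := fun q => WithLp.toLp 2 (fun e => ⟪b q, a e⟫) with hR
  have hWR : ∀ n, W n = ∑ t : Fin n → ι, (Matrix.gram ℝ (R ∘ t)).det := by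
    intro n
    have h := sum_det_submatrix_mul_transpose A n
    have e1 : Aᵀ * A = Matrix.gram ℝ a := by
      ext e e'
      rw [Matrix.mul_apply, Matrix.gram_apply, ← b.sum_inner_mul_inner]
      simp [hA, real_inner_comm]
    have e2 : A * Aᵀ = Matrix.gram ℝ R := by
      ext q q'
      rw [Matrix.mul_apply, Matrix.gram_apply]
      simp [hA, hR, PiLp.inner_apply, mul_comm]
    rw [e1, e2] at h
    exact h
  have hle := sum_det_gram_le R top r m htop
  rw [← hWR, ← hWR] at hle
  have hRn : ∑ q ∈ topᶜ, ‖R q‖ ^ 2 = η := by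
    refine Finset.sum_congr rfl fun q _ => ?_
    rw [EuclideanSpace.norm_sq_eq]
    simp [hR]
  rw [hRn] at hle
  have hmk : (m : ℝ) + 1 = k + r := by exact_mod_cast hm
  rw [hmk, add_sub_cancel_right] at hle
  linarith

theorem lapM_mulVec {V : Type*} [Fintype V] [DecidableEq V] (W : V → V → ℝ) (w : V → ℝ) (a : V) :
    (lapM W).mulVec w a = ∑ b, W a b * (w a - w b) := by
  have h1 : ∀ b, lapM W a b * w b = (if a = b then (∑ c with c ≠ a, W a c) * w a else 0) -
      (if b ≠ a then W a b * w b else 0) := by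
    intro b
    by_cases h : a = b
    · subst h; simp [lapM]
    · simp [lapM, h, Ne.symm h]
  simp only [Matrix.mulVec, dotProduct, h1, Finset.sum_sub_distrib, Finset.sum_ite_eq,
    Finset.mem_univ, if_true]
  rw [← Finset.sum_filter, Finset.sum_mul, ← Finset.sum_sub_distrib,
    ← Finset.sum_filter_add_sum_filter_not Finset.univ (· ≠ a) fun b => W a b * (w a - w b)]
  have h2 : ∑ b with ¬ b ≠ a, W a b * (w a - w b) = 0 :=
    Finset.sum_eq_zero fun b hb => by
      have : b = a := by simpa using hb
      simp [this]
  rw [h2, add_zero]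
  exact Finset.sum_congr rfl fun b _ => by ring

theorem dotProduct_lapM_mulVec {V : Type*} [Fintype V] [DecidableEq V] (W : V → V → ℝ)
    (hW : ∀ u v, W u v = W v u) (w : V → ℝ) :
    w ⬝ᵥ (lapM W).mulVec w = (∑ u, ∑ v, W u v * (w u - w v) ^ 2) / 2 := by
  have h1 : w ⬝ᵥ (lapM W).mulVec w = ∑ u, ∑ v, W u v * (w u - w v) * w u := by
    simp only [dotProduct, lapM_mulVec, Finset.mul_sum]
    exact Finset.sum_congr rfl fun u _ => Finset.sum_congr rfl fun v _ => by ring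
  have h2 : ∑ u, ∑ v, W u v * (w u - w v) * w u = ∑ u, ∑ v, W u v * (w v - w u) * w v := by
    rw [Finset.sum_comm]
    exact Finset.sum_congr rfl fun u _ => Finset.sum_congr rfl fun v _ => by rw [hW]
  have h3 : ∑ u, ∑ v, W u v * (w u - w v) ^ 2 = ∑ u, ∑ v, W u v * (w u - w v) * w u +
      ∑ u, ∑ v, W u v * (w v - w u) * w v := by
    simp only [← Finset.sum_add_distrib]
    exact Finset.sum_congr rfl fun u _ => Finset.sum_congr rfl fun v _ => by ring
  rw [h3, ← h2, h1]; ring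

theorem dotProduct_lapM_mulVec_nonneg {V : Type*} [Fintype V] [DecidableEq V] (W : V → V → ℝ)
    (hW : ∀ u v, W u v = W v u) (hW0 : ∀ u v, 0 ≤ W u v) (w : V → ℝ) :
    0 ≤ w ⬝ᵥ (lapM W).mulVec w := by
  rw [dotProduct_lapM_mulVec W hW]
  have : 0 ≤ ∑ u, ∑ v, W u v * (w u - w v) ^ 2 := Finset.sum_nonneg fun u _ =>
    Finset.sum_nonneg fun v _ => mul_nonneg (hW0 u v) (sq_nonneg _)
  positivity

theorem dotProduct_lapM_mulVec_pos {V : Type*} [Fintype V] [DecidableEq V] (W : V → V → ℝ)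
    (hW : ∀ u v, W u v = W v u) (hW0 : ∀ u v, 0 ≤ W u v) (w : V → ℝ)
    (hw : (lapM W).mulVec w ≠ 0) : 0 < w ⬝ᵥ (lapM W).mulVec w := by
  refine lt_of_le_of_ne (dotProduct_lapM_mulVec_nonneg W hW hW0 w) fun h => hw ?_
  rw [dotProduct_lapM_mulVec W hW] at h
  have h0 : ∑ u, ∑ v, W u v * (w u - w v) ^ 2 = 0 := by linarith
  have hn : ∀ u v, 0 ≤ W u v * (w u - w v) ^ 2 := fun u v => mul_nonneg (hW0 u v) (sq_nonneg _)
  ext a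
  rw [lapM_mulVec]
  refine Finset.sum_eq_zero fun b _ => ?_
  have h1 := (Finset.sum_eq_zero_iff_of_nonneg fun u _ => Finset.sum_nonneg fun v _ => hn u v).1
    h0 a (Finset.mem_univ _)
  have h2 := (Finset.sum_eq_zero_iff_of_nonneg fun v _ => hn a v).1 h1 b (Finset.mem_univ _)
  rcases mul_eq_zero.1 h2 with h | h
  · rw [h, zero_mul]
  · rw [pow_eq_zero_iff two_ne_zero] at h; rw [h, mul_zero]

/-- The linear map whose kernel consists of the `h` whose image under `L` is orthogonal to `Z`. -/
def dotRestrict {n M : Type*} [Fintype n] [AddCommGroup M] [Module ℝ M] (L : M →ₗ[ℝ] (n → ℝ))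
    (Z : Submodule ℝ (n → ℝ)) : M →ₗ[ℝ] Module.Dual ℝ Z where
  toFun h :=
    { toFun := fun z => L h ⬝ᵥ z.1
      map_add' := fun z z' => by simp [dotProduct_add]
      map_smul' := fun c z => by simp [dotProduct_smul] }
  map_add' h h' := by ext z; simp [add_dotProduct]
  map_smul' c h := by ext z; simp [smul_dotProduct]

theorem mem_ker_dotRestrict {n M : Type*} [Fintype n] [AddCommGroup M] [Module ℝ M]
    (L : M →ₗ[ℝ] (n → ℝ)) (Z : Submodule ℝ (n → ℝ)) (h : M) :
    h ∈ LinearMap.ker (dotRestrict L Z) ↔ ∀ z ∈ Z, L h ⬝ᵥ z = 0 := by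
  rw [LinearMap.mem_ker]
  refine ⟨fun hh z hz => ?_, fun hh => ?_⟩
  · exact congrArg (fun φ : Module.Dual ℝ Z => φ ⟨z, hz⟩) hh
  · ext z; exact hh z.1 z.2

theorem bddBelow_rayleigh {n : Type*} [Fintype n] (X Y : Matrix n n ℝ)
    (hX : ∀ w, 0 ≤ w ⬝ᵥ X.mulVec w) (hY : ∀ w, Y.mulVec w ≠ 0 → 0 < w ⬝ᵥ Y.mulVec w)
    (Z : Submodule ℝ (n → ℝ)) :
    BddBelow (Set.range fun w : {w : n → ℝ // (∀ z ∈ Z, w ⬝ᵥ z = 0) ∧ Y.mulVec w ≠ 0} =>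
      (w.1 ⬝ᵥ X.mulVec w.1) / (w.1 ⬝ᵥ Y.mulVec w.1)) := by
  refine ⟨0, ?_⟩
  rintro _ ⟨w, rfl⟩
  exact div_nonneg (hX _) (hY _ w.2.2).le

/-- Below the rank of `Y`, the infima defining the generalized eigenvalue are bounded above
uniformly in the subspace. -/
theorem bddAbove_genEig {n : Type*} [Fintype n] (X Y : Matrix n n ℝ)
    (hX : ∀ w, 0 ≤ w ⬝ᵥ X.mulVec w) (hY : ∀ w, Y.mulVec w ≠ 0 → 0 < w ⬝ᵥ Y.mulVec w)
    (r : ℕ) (hr : r + 1 ≤ Y.rank) :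
    BddAbove (Set.range fun Z : {Z : Submodule ℝ (n → ℝ) // Module.finrank ℝ Z ≤ r} =>
      ⨅ w : {w : n → ℝ // (∀ z ∈ Z.1, w ⬝ᵥ z = 0) ∧ Y.mulVec w ≠ 0},
        (w.1 ⬝ᵥ X.mulVec w.1) / (w.1 ⬝ᵥ Y.mulVec w.1)) := by
  obtain ⟨K, hK⟩ := Submodule.exists_isCompl (LinearMap.ker Y.mulVecLin)
  have hKne : ∀ w : K, w ≠ 0 → Y.mulVec w.1 ≠ 0 := by
    intro w hw h
    apply hw
    have := (Submodule.disjoint_def.1 hK.disjoint) w.1 (by simpa using h) w.2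
    exact Subtype.ext this
  have hKr : r + 1 ≤ Module.finrank ℝ K := by
    have h1 := Submodule.finrank_add_eq_of_isCompl hK
    have h2 := LinearMap.finrank_range_add_finrank_ker Y.mulVecLin
    have h3 : Y.rank = Module.finrank ℝ (LinearMap.range Y.mulVecLin) := rfl
    omega
  have := FiniteDimensional.proper ℝ K
  have hcont : ContinuousOn (fun w : K => (w.1 ⬝ᵥ X.mulVec w.1) / (w.1 ⬝ᵥ Y.mulVec w.1))
      (Metric.sphere (0 : K) 1) := by
    refine ContinuousOn.div ?_ ?_ fun w hw => ?_
    · exact (Continuous.dotProduct continuous_subtype_val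
        (Continuous.matrix_mulVec continuous_const continuous_subtype_val)).continuousOn
    · exact (Continuous.dotProduct continuous_subtype_val
        (Continuous.matrix_mulVec continuous_const continuous_subtype_val)).continuousOn
    · exact (hY _ (hKne w (ne_zero_of_mem_unit_sphere ⟨w, hw⟩))).ne'
  obtain ⟨B, hB⟩ := (isCompact_sphere (0 : K) 1).bddAbove_image hcont
  refine ⟨B, ?_⟩
  rintro _ ⟨⟨Z, hZ⟩, rfl⟩
  have hker : LinearMap.ker (dotRestrict K.subtype Z) ≠ ⊥ := by
    apply LinearMap.ker_ne_bot_of_finrank_lt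
    rw [Subspace.dual_finrank_eq]
    omega
  obtain ⟨w, hw, hw0⟩ := Submodule.exists_mem_ne_zero_of_ne_bot hker
  have hu : (‖w‖⁻¹ • w) ∈ Metric.sphere (0 : K) 1 := by
    simp [norm_smul, hw0]
  have huker := (mem_ker_dotRestrict K.subtype Z _).1
    (Submodule.smul_mem _ ‖w‖⁻¹ hw)
  refine (ciInf_le (bddBelow_rayleigh X Y hX hY Z) ⟨(‖w‖⁻¹ • w : K).1, huker, ?_⟩).trans
    (hB ⟨_, hu, rfl⟩)
  exact hKne _ (smul_ne_zero (inv_ne_zero (norm_ne_zero_iff.2 hw0)) hw0)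

theorem le_genEig {n : Type*} [Fintype n] (X Y : Matrix n n ℝ)
    (hX : ∀ w, 0 ≤ w ⬝ᵥ X.mulVec w) (hY : ∀ w, Y.mulVec w ≠ 0 → 0 < w ⬝ᵥ Y.mulVec w)
    (r : ℕ) (hr : r + 1 ≤ Y.rank) (c : ℝ)
    (hc : ∀ w, c * (w ⬝ᵥ Y.mulVec w) ≤ w ⬝ᵥ X.mulVec w) : c ≤ genEig X Y (r + 1) := by
  refine le_ciSup_of_le (bddAbove_genEig X Y hX hY r hr) ⟨⊥, by simp⟩ ?_
  have : Nonempty {w : n → ℝ // (∀ z ∈ (⊥ : Submodule ℝ (n → ℝ)), w ⬝ᵥ z = 0) ∧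
      Y.mulVec w ≠ 0} := by
    by_contra! h
    have h0 : Y.mulVecLin = 0 := by
      ext1 w
      by_contra hw
      exact h.false ⟨w, by simp, hw⟩
    have : Y.rank = 0 := by
      rw [Matrix.rank, h0, LinearMap.range_zero, finrank_bot]
    omega
  exact le_ciInf fun w => (le_div_iff₀ (hY _ w.2.2)).2 (hc _)

theorem exists_subspace_of_lt_genEig {n : Type*} [Fintype n] (X Y : Matrix n n ℝ)
    (hX : ∀ w, 0 ≤ w ⬝ᵥ X.mulVec w)
    (hY : ∀ w, Y.mulVec w ≠ 0 → 0 < w ⬝ᵥ Y.mulVec w)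
    (r : ℕ) (c : ℝ) (hc : c < genEig X Y (r + 1)) :
    ∃ Z : Submodule ℝ (n → ℝ), Module.finrank ℝ Z ≤ r ∧
      ∀ w, (∀ z ∈ Z, w ⬝ᵥ z = 0) → c * (w ⬝ᵥ Y.mulVec w) ≤ w ⬝ᵥ X.mulVec w := by
  have : Nonempty {Z : Submodule ℝ (n → ℝ) // Module.finrank ℝ Z ≤ r + 1 - 1} :=
    ⟨⟨⊥, by simp⟩⟩
  obtain ⟨Z, hZ⟩ := exists_lt_of_lt_ciSup hc
  refine ⟨Z.1, Z.2, fun w hw => ?_⟩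
  by_cases h : Y.mulVec w = 0
  · rw [h]; simpa using hX w
  · rw [← le_div_iff₀ (hY w h)]
    exact hZ.le.trans (ciInf_le (bddBelow_rayleigh X Y hX hY Z.1) ⟨w, hw, h⟩)

/-- An orthonormal basis all but `r` of whose members give coordinate vectors orthogonal to `Z`. -/
theorem exists_orthonormalBasis_adapted {V H : Type*} [Fintype V] [NormedAddCommGroup H]
    [InnerProductSpace ℝ H] [FiniteDimensional ℝ H] (y : V → H) (Z : Submodule ℝ (V → ℝ)) :
    ∃ (B : Finset H) (b : OrthonormalBasis B ℝ H) (top : Finset B),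
      top.card ≤ Module.finrank ℝ Z ∧
        ∀ q ∉ top, ∀ z ∈ Z, (fun u => ⟪b q, y u⟫) ⬝ᵥ z = 0 := by
  classical
  let L : H →ₗ[ℝ] (V → ℝ) :=
    { toFun := fun q u => ⟪q, y u⟫
      map_add' := fun q q' => by ext u; simp [inner_add_left]
      map_smul' := fun c q => by ext u; simp [inner_smul_left] }
  set Q := LinearMap.ker (dotRestrict L Z) with hQ
  have hdim : Module.finrank ℝ H ≤ Module.finrank ℝ Q + Module.finrank ℝ Z := by
    have h1 := LinearMap.finrank_range_add_finrank_ker (dotRestrict L Z)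
    have h2 := Submodule.finrank_le (LinearMap.range (dotRestrict L Z))
    rw [Subspace.dual_finrank_eq] at h2
    rw [← hQ] at h1
    omega
  set c := stdOrthonormalBasis ℝ Q with hcdef
  have hon : Orthonormal ℝ (fun i => (c i : H)) :=
    c.orthonormal.comp_linearIsometry Q.subtypeₗᵢ
  obtain ⟨B, b, hB, hb⟩ := hon.toSubtypeRange.exists_orthonormalBasis_extension
  refine ⟨B, b, Finset.univ.filter fun q => (q : H) ∉ Q, ?_, fun q hq => ?_⟩
  · have hcard : Module.finrank ℝ H = Fintype.card B := Module.finrank_eq_card_basis b.toBasis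
    have h2 : Module.finrank ℝ Q ≤ (Finset.univ.filter fun q : B => (q : H) ∈ Q).card := by
      have : (Finset.univ : Finset (Fin (Module.finrank ℝ Q))).card ≤
          (Finset.univ.filter fun q : B => (q : H) ∈ Q).card := by
        refine Finset.card_le_card_of_injOn (fun i => ⟨c i, hB ⟨i, rfl⟩⟩) (fun i _ => ?_) ?_
        · simp
        · intro i _ j _ hij
          exact c.toBasis.injective (by simpa using hij)
      simpa using this
    have h3 := Finset.card_filter_add_card_filter_not (s := (Finset.univ : Finset B))
      (fun q : B => (q : H) ∈ Q)
    rw [Finset.card_univ] at h3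
    omega
  · have : (q : H) ∈ Q := by simpa using hq
    rw [hb]
    exact (mem_ker_dotRestrict L Z _).1 this

/-- Enlarging a subspace decreases the distance to it. -/
theorem norm_sub_starProjection_le {H : Type*} [NormedAddCommGroup H] [InnerProductSpace ℝ H]
    (K : Submodule ℝ H) [K.HasOrthogonalProjection] (y p : H) (hp : p ∈ K) :
    ‖y - K.starProjection y‖ ≤ ‖y - p‖ := by
  rw [Submodule.starProjection_minimal]
  exact ciInf_le ⟨0, by rintro _ ⟨z, rfl⟩; exact norm_nonneg _⟩ (⟨p, hp⟩ : K)

theorem exists_seeds_residual_le {V H : Type*} [Fintype V] [DecidableEq V] [NormedAddCommGroup H]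
    [InnerProductSpace ℝ H] [FiniteDimensional ℝ H] (C D : V → V → ℝ)
    (hCsymm : ∀ u v, C u v = C v u) (hCnonneg : ∀ u v, 0 ≤ C u v)
    (hDsymm : ∀ u v, D u v = D v u) (hDnonneg : ∀ u v, 0 ≤ D u v)
    (r k m : ℕ) (hm : m + 1 = k + r) (y : V → H) (c : ℝ) (hc0 : 0 ≤ c)
    (hc : c < genEig (lapM C) (lapM D) (r + 1)) :
    ∃ S : Finset V, S.card ≤ 2 * m ∧
      c * (k * ∑ u, ∑ v, D u v *
          ‖(y u - y v) - (Submodule.span ℝ (y '' S)).starProjection (y u - y v)‖ ^ 2)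
        ≤ (k + r) * ∑ u, ∑ v, C u v * ‖y u - y v‖ ^ 2 := by
  obtain ⟨Z, hZ, hZw⟩ := exists_subspace_of_lt_genEig _ _
    (dotProduct_lapM_mulVec_nonneg C hCsymm hCnonneg)
    (dotProduct_lapM_mulVec_pos D hDsymm hDnonneg) r c hc
  classical
  obtain ⟨B, b, top, htop, horth⟩ := exists_orthonormalBasis_adapted y Z
  obtain ⟨n, hn, s, hs⟩ := exists_columns_residual_le b
    (fun e : V × V => √(D e.1 e.2) • (y e.1 - y e.2)) top r k m (htop.trans hZ) hm
  set K' := Submodule.span ℝ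
    (Set.range ((fun e : V × V => √(D e.1 e.2) • (y e.1 - y e.2)) ∘ s)) with hK'
  set S : Finset V := Finset.univ.image (fun i => (s i).1) ∪ Finset.univ.image (fun i => (s i).2)
    with hS
  refine ⟨S, ?_, ?_⟩
  · refine (Finset.card_union_le _ _).trans ?_
    have h1 := Finset.card_image_le (s := (Finset.univ : Finset (Fin n))) (f := fun i => (s i).1)
    have h2 := Finset.card_image_le (s := (Finset.univ : Finset (Fin n))) (f := fun i => (s i).2)
    simp only [Finset.card_univ, Fintype.card_fin] at h1 h2
    omega
  set K := Submodule.span ℝ (y '' S) with hK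
  have hKK : K' ≤ K := by
    rw [hK', Submodule.span_le]
    rintro _ ⟨i, rfl⟩
    refine Submodule.smul_mem _ _ (Submodule.sub_mem _ ?_ ?_)
    · exact Submodule.subset_span ⟨_, by simp [hS], rfl⟩
    · exact Submodule.subset_span ⟨_, by simp [hS], rfl⟩
  have hres : ∑ u, ∑ v, D u v * ‖(y u - y v) - K.starProjection (y u - y v)‖ ^ 2 ≤
      ∑ e : V × V, ‖√(D e.1 e.2) • (y e.1 - y e.2) -
        K'.starProjection (√(D e.1 e.2) • (y e.1 - y e.2))‖ ^ 2 := by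
    rw [Fintype.sum_prod_type]
    refine Finset.sum_le_sum fun u _ => Finset.sum_le_sum fun v _ => ?_
    have h1 : D u v * ‖(y u - y v) - K.starProjection (y u - y v)‖ ^ 2 =
        ‖√(D u v) • (y u - y v) - K.starProjection (√(D u v) • (y u - y v))‖ ^ 2 := by
      rw [map_smul, ← smul_sub, norm_smul, mul_pow, Real.norm_eq_abs, sq_abs,
        Real.sq_sqrt (hDnonneg u v)]
    rw [h1]
    exact pow_le_pow_left₀ (norm_nonneg _)
      (norm_sub_starProjection_le _ _ _ (hKK (Submodule.starProjection_apply_mem _ _))) 2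
  have hη : c * ∑ q ∈ topᶜ, ∑ e : V × V, ⟪b q, √(D e.1 e.2) • (y e.1 - y e.2)⟫ ^ 2 ≤
      ∑ u, ∑ v, C u v * ‖y u - y v‖ ^ 2 := by
    have h1 : ∀ q, ∑ e : V × V, ⟪b q, √(D e.1 e.2) • (y e.1 - y e.2)⟫ ^ 2 =
        ∑ u, ∑ v, D u v * (⟪b q, y u⟫ - ⟪b q, y v⟫) ^ 2 := by
      intro q
      rw [Fintype.sum_prod_type]
      refine Finset.sum_congr rfl fun u _ => Finset.sum_congr rfl fun v _ => ?_
      rw [inner_smul_right, mul_pow, Real.sq_sqrt (hDnonneg u v), inner_sub_right]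
    have h2 : ∀ q ∈ topᶜ, c * ∑ u, ∑ v, D u v * (⟪b q, y u⟫ - ⟪b q, y v⟫) ^ 2 ≤
        ∑ u, ∑ v, C u v * (⟪b q, y u⟫ - ⟪b q, y v⟫) ^ 2 := by
      intro q hq
      have := hZw _ (horth q (by simpa using hq))
      rw [dotProduct_lapM_mulVec C hCsymm, dotProduct_lapM_mulVec D hDsymm] at this
      linarith
    have h3 : ∑ q, ∑ u, ∑ v, C u v * (⟪b q, y u⟫ - ⟪b q, y v⟫) ^ 2 =
        ∑ u, ∑ v, C u v * ‖y u - y v‖ ^ 2 := by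
      rw [Finset.sum_comm]
      refine Finset.sum_congr rfl fun u _ => ?_
      rw [Finset.sum_comm]
      refine Finset.sum_congr rfl fun v _ => ?_
      rw [← Finset.mul_sum, ← b.sum_sq_norm_inner_right]
      simp [inner_sub_right]
    simp only [h1]
    rw [Finset.mul_sum, ← h3]
    refine (Finset.sum_le_sum h2).trans ?_
    exact Finset.sum_le_sum_of_subset_of_nonneg (Finset.subset_univ _) fun q _ _ =>
      Finset.sum_nonneg fun u _ => Finset.sum_nonneg fun v _ =>
        mul_nonneg (hCnonneg u v) (sq_nonneg _)
  have hk : (0 : ℝ) ≤ k := Nat.cast_nonneg k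
  calc _ ≤ c * (k * ∑ e : V × V, ‖√(D e.1 e.2) • (y e.1 - y e.2) -
        K'.starProjection (√(D e.1 e.2) • (y e.1 - y e.2))‖ ^ 2) := by gcongr
    _ ≤ c * ((k + r) * ∑ q ∈ topᶜ, ∑ e : V × V, ⟪b q, √(D e.1 e.2) • (y e.1 - y e.2)⟫ ^ 2) :=
        mul_le_mul_of_nonneg_left hs hc0
    _ = (k + r) * (c * ∑ q ∈ topᶜ, ∑ e : V × V,
          ⟪b q, √(D e.1 e.2) • (y e.1 - y e.2)⟫ ^ 2) := by ring
    _ ≤ _ := by gcongr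

theorem exists_seeds_genEig_mul_residual_le {V H : Type*} [Fintype V] [DecidableEq V]
    [NormedAddCommGroup H] [InnerProductSpace ℝ H] [FiniteDimensional ℝ H] (C D : V → V → ℝ)
    (hCsymm : ∀ u v, C u v = C v u) (hCnonneg : ∀ u v, 0 ≤ C u v)
    (hDsymm : ∀ u v, D u v = D v u) (hDnonneg : ∀ u v, 0 ≤ D u v)
    (r k m : ℕ) (hm : m + 1 = k + r) (y : V → H) (hpos : 0 < genEig (lapM C) (lapM D) (r + 1)) :
    ∃ S : Finset V, S.card ≤ 2 * m ∧
      genEig (lapM C) (lapM D) (r + 1) * (k * ∑ u, ∑ v, D u v *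
          ‖(y u - y v) - (Submodule.span ℝ (y '' S)).starProjection (y u - y v)‖ ^ 2)
        ≤ (k + r) * ∑ u, ∑ v, C u v * ‖y u - y v‖ ^ 2 := by
  set res : Finset V → ℝ := fun S => k * ∑ u, ∑ v, D u v *
    ‖(y u - y v) - (Submodule.span ℝ (y '' S)).starProjection (y u - y v)‖ ^ 2 with hres
  obtain ⟨S, hS, hmin⟩ := Finset.exists_min_image
    (Finset.univ.filter fun S : Finset V => S.card ≤ 2 * m) res ⟨∅, by simp⟩
  refine ⟨S, by simpa using hS, ?_⟩
  change genEig (lapM C) (lapM D) (r + 1) * res S ≤ _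
  set B := (k + r) * ∑ u, ∑ v, C u v * ‖y u - y v‖ ^ 2 with hB
  have hB0 : 0 ≤ B := mul_nonneg (by positivity) <| Finset.sum_nonneg fun u _ =>
    Finset.sum_nonneg fun v _ => mul_nonneg (hCnonneg u v) (sq_nonneg _)
  have hlim : ∀ c, 0 ≤ c → c < genEig (lapM C) (lapM D) (r + 1) → c * res S ≤ B := by
    intro c hc0 hc
    obtain ⟨S', hS', h⟩ := exists_seeds_residual_le C D hCsymm hCnonneg hDsymm hDnonneg r k m hm
      y c hc0 hc
    exact (mul_le_mul_of_nonneg_left (hmin S' (by simpa using hS')) hc0).trans h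
  by_contra! hcon
  have hres0 : 0 < res S := pos_of_mul_pos_right (hB0.trans_lt hcon) hpos.le
  have h1 : B / res S < genEig (lapM C) (lapM D) (r + 1) := (div_lt_iff₀ hres0).2 hcon
  obtain ⟨c, hc1, hc2⟩ := exists_between h1
  have h2 := hlim c ((div_nonneg hB0 hres0.le).trans hc1.le) hc2
  exact absurd h2 (not_le.2 ((div_lt_iff₀ hres0).1 hc1))

/-- The Lasserre vector of `S` labeled by the indicator of `A`. -/
def labVec {V : Type*} [DecidableEq V] {d : ℕ}
    (x : Finset V → (V → Bool) → EuclideanSpace ℝ (Fin d)) (S A : Finset V) :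
    EuclideanSpace ℝ (Fin d) :=
  x S fun v => decide (v ∈ A)

namespace IsLasserre

variable {V : Type*} [Fintype V] [DecidableEq V] {R d : ℕ}
  {x : Finset V → (V → Bool) → EuclideanSpace ℝ (Fin d)}

theorem labVec_singleton (hx : IsLasserre V R d x) (u : V) : labVec x {u} {u} = xVec x u :=
  hx.localDep _ _ _ fun v hv => by simpa using hv

theorem labVec_insert (hx : IsLasserre V R d x) {S A : Finset V} {u : V} (hu : u ∉ S)
    (hS : S.card ≤ R) (hA : A ⊆ S) :
    labVec x (insert u S) A + labVec x (insert u S) (insert u A) = labVec x S A := by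
  have h := hx.marginal (insert u S) ((Finset.card_insert_le _ _).trans (by omega)) u
    (Finset.mem_insert_self _ _) fun v => decide (v ∈ A)
  rw [Finset.erase_insert hu] at h
  rw [labVec, labVec, labVec, ← h]
  congr 1
  · refine hx.localDep _ _ _ fun v _ => ?_
    by_cases hv : v = u
    · have : v ∉ A := fun h => hu (hv ▸ hA h)
      simp [hv, hv ▸ this]
    · simp [hv]
  · refine hx.localDep _ _ _ fun v _ => ?_
    by_cases hv : v = u
    · subst hv; simp
    · simp [hv]

theorem sum_labVec (hx : IsLasserre V R d x) (S : Finset V) (hS : S.card ≤ R + 1) :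
    ∑ A ∈ S.powerset, labVec x S A = labVec x ∅ ∅ := by
  induction S using Finset.induction_on with
  | empty => simp
  | insert u S hu ih =>
    rw [Finset.card_insert_of_notMem hu] at hS
    rw [Finset.sum_powerset_insert hu, ← Finset.sum_add_distrib, ← ih (by omega)]
    exact Finset.sum_congr rfl fun A hA =>
      hx.labVec_insert hu (by omega) (Finset.mem_powerset.1 hA)

theorem inner_labVec_eq_zero (hx : IsLasserre V R d x) {S A B : Finset V} (hS : S.card ≤ R + 1)
    (hA : A ⊆ S) (hB : B ⊆ S) (hAB : A ≠ B) : ⟪labVec x S A, labVec x S B⟫ = 0 := by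
  refine hx.ortho S S hS hS _ _ ?_
  by_contra! h
  refine hAB (Finset.ext fun v => ⟨fun hv => ?_, fun hv => ?_⟩)
  · simpa [hv] using h v (by simpa using hA hv)
  · simpa [hv] using h v (by simpa using hB hv)

theorem inner_nonneg (hx : IsLasserre V R d x) {S T : Finset V} (hST : (S ∪ T).card ≤ R + 1)
    (f g : V → Bool) : 0 ≤ ⟪x S f, x T g⟫ := by
  have hS : S.card ≤ R + 1 := (Finset.card_le_card Finset.subset_union_left).trans hST
  have hT : T.card ≤ R + 1 := (Finset.card_le_card Finset.subset_union_right).trans hST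
  by_cases h : ∃ u ∈ S ∩ T, f u ≠ g u
  · exact (hx.ortho S T hS hT f g h).ge
  · push Not at h
    rw [hx.localDep S f (fun v => if v ∈ S then f v else g v) fun u hu => by simp [hu],
      hx.localDep T g (fun v => if v ∈ S then f v else g v) fun u hu => by
        by_cases hS : u ∈ S
        · simp [hS, h u (Finset.mem_inter.2 ⟨hS, hu⟩)]
        · simp [hS],
      hx.consistent S T (S ∪ T) (S ∪ T) hS hT hST hST (by simp)]
    exact real_inner_self_nonneg

theorem inner_labVec_empty (hx : IsLasserre V R d x) {S : Finset V} (hS : S.card ≤ R + 1)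
    (A : Finset V) : ⟪labVec x S A, labVec x ∅ ∅⟫ = ‖labVec x S A‖ ^ 2 := by
  have h : labVec x ∅ ∅ = x ∅ fun v => decide (v ∈ A) :=
    hx.localDep _ _ _ fun v hv => absurd hv (Finset.notMem_empty v)
  rw [h, labVec, hx.consistent S ∅ S S hS (by simp) hS hS (by simp), real_inner_self_eq_norm_sq]

theorem inner_xVec_labVec_le (hx : IsLasserre V R d x) {S : Finset V} (hS : S.card ≤ R)
    (A : Finset V) (u : V) : ⟪xVec x u, labVec x S A⟫ ≤ ‖labVec x S A‖ ^ 2 := by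
  have h := hx.labVec_insert (S := ∅) (A := ∅) (u := u) (by simp) (by simp) (by simp)
  rw [insert_empty_eq, hx.labVec_singleton] at h
  have h0 : 0 ≤ ⟪labVec x {u} ∅, labVec x S A⟫ := hx.inner_nonneg
    ((Finset.card_union_le _ _).trans (by rw [Finset.card_singleton]; omega)) _ _
  rw [← hx.inner_labVec_empty (by omega), ← h, inner_add_right, real_inner_comm (xVec x u),
    real_inner_comm (labVec x {u} ∅)]
  linarith

theorem inner_xVec_labVec_nonneg (hx : IsLasserre V R d x) {S : Finset V} (hS : S.card ≤ R)
    (A : Finset V) (u : V) : 0 ≤ ⟪xVec x u, labVec x S A⟫ :=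
  hx.inner_nonneg ((Finset.card_union_le _ _).trans (by rw [Finset.card_singleton]; omega)) _ _

/-- Conditioning on the labels of `S` does not increase the expected separation of `u` and `v`. -/
theorem sum_abs_inner_le (hx : IsLasserre V R d x) {S : Finset V} (hS : S.card + 1 ≤ R)
    (u v : V) :
    ∑ A ∈ S.powerset, |⟪xVec x u, labVec x S A⟫ - ⟪xVec x v, labVec x S A⟫|
      ≤ ‖xVec x u - xVec x v‖ ^ 2 := by
  by_cases huv : u = v
  · simp [huv]
  have hu := hx.labVec_insert (S := {u}) (A := {u}) (u := v)
    (by simpa using Ne.symm huv) (by rw [Finset.card_singleton]; omega) subset_rfl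
  have hv := hx.labVec_insert (S := {v}) (A := {v}) (u := u)
    (by simpa using huv) (by rw [Finset.card_singleton]; omega) subset_rfl
  rw [hx.labVec_singleton] at hu hv
  rw [show (insert v {u} : Finset V) = {u, v} from Finset.pair_comm v u] at hu
  have hcard : ({u, v} : Finset V).card ≤ 2 := Finset.card_le_two
  have hunion : ({u, v} ∪ S : Finset V).card ≤ R + 1 := (Finset.card_union_le _ _).trans (by omega)
  set α := labVec x {u, v} {u} with hα
  set β := labVec x {u, v} {v} with hβ
  have hdiff : xVec x u - xVec x v = α - β := by rw [← hu, ← hv]; abel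
  have hαβ : ⟪α, β⟫ = 0 :=
    hx.inner_labVec_eq_zero (by omega) (by simp) (by simp) (by simpa using huv)
  have hbound : ∀ A ∈ S.powerset,
      |⟪xVec x u, labVec x S A⟫ - ⟪xVec x v, labVec x S A⟫|
        ≤ ⟪α, labVec x S A⟫ + ⟪β, labVec x S A⟫ := by
    intro A _
    have h1 : 0 ≤ ⟪α, labVec x S A⟫ := hx.inner_nonneg hunion _ _
    have h2 : 0 ≤ ⟪β, labVec x S A⟫ := hx.inner_nonneg hunion _ _
    rw [← inner_sub_left, hdiff, inner_sub_left, abs_le]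
    constructor <;> linarith
  refine (Finset.sum_le_sum hbound).trans ?_
  rw [Finset.sum_add_distrib, ← inner_sum, ← inner_sum, hx.sum_labVec S (by omega),
    hx.inner_labVec_empty (by omega), hx.inner_labVec_empty (by omega), hdiff,
    norm_sub_sq_real, hαβ]
  linarith

theorem xVec_mem_span_labVec (hx : IsLasserre V R d x) {S : Finset V} (hS : S.card ≤ R + 1)
    {u : V} (hu : u ∈ S) : xVec x u ∈ Submodule.span ℝ (labVec x S '' S.powerset) := by
  have key : ∀ T : Finset V, u ∉ T → T.card ≤ R →
      xVec x u ∈ Submodule.span ℝ (labVec x (insert u T) '' (insert u T).powerset) := by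
    intro T
    induction T using Finset.induction_on with
    | empty =>
      intro _ _
      refine Submodule.subset_span ⟨{u}, by simp, ?_⟩
      rw [insert_empty_eq, hx.labVec_singleton]
    | insert w T hw ih =>
      intro huT hcard
      rw [Finset.card_insert_of_notMem hw] at hcard
      have huw : u ≠ w := fun h => huT (by simp [h])
      have huT' : u ∉ T := fun h => huT (Finset.mem_insert_of_mem h)
      refine Submodule.span_le.2 ?_ (ih huT' (by omega))
      rintro _ ⟨A, hA, rfl⟩
      have hA : A ⊆ insert u T := Finset.mem_powerset.1 (Finset.mem_coe.1 hA)
      rw [Finset.insert_comm]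
      rw [← hx.labVec_insert (u := w) (S := insert u T) (by simp [hw, huw.symm])
        (by rw [Finset.card_insert_of_notMem huT']; omega) hA]
      refine Submodule.add_mem _ (Submodule.subset_span ⟨A, ?_, rfl⟩)
        (Submodule.subset_span ⟨insert w A, ?_, rfl⟩)
      · exact Finset.mem_coe.2 (Finset.mem_powerset.2 (hA.trans (Finset.subset_insert _ _)))
      · exact Finset.mem_coe.2 (Finset.mem_powerset.2 (Finset.insert_subset_insert w hA))
  have h := key (S.erase u) (Finset.notMem_erase _ _) (by
    rw [Finset.card_erase_of_mem hu]; omega)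
  rwa [Finset.insert_erase hu] at h

end IsLasserre

/-- Bessel-type bound for a family of orthogonal, not necessarily nonzero, vectors. -/
theorem norm_sq_sub_norm_sub_sq_le {ι H : Type*} [NormedAddCommGroup H]
    [InnerProductSpace ℝ H] (P : Finset ι) (y : ι → H)
    (horth : ∀ i ∈ P, ∀ j ∈ P, i ≠ j → ⟪y i, y j⟫ = 0) (w p : H)
    (hp : p ∈ Submodule.span ℝ (y '' P)) :
    ‖w‖ ^ 2 - ‖w - p‖ ^ 2 ≤ ∑ i ∈ P, ⟪w, y i⟫ ^ 2 / ‖y i‖ ^ 2 := by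
  classical
  obtain ⟨c, rfl⟩ := (Submodule.mem_span_image_finset_iff_exists_fun' ℝ).1 hp
  have h1 : ‖∑ i ∈ P, c i • y i‖ ^ 2 = ∑ i ∈ P, c i ^ 2 * ‖y i‖ ^ 2 := by
    rw [← real_inner_self_eq_norm_sq, sum_inner]
    refine Finset.sum_congr rfl fun i hi => ?_
    rw [inner_sum, Finset.sum_eq_single_of_mem i hi fun j hj hji => by
      rw [inner_smul_left, inner_smul_right, horth i hi j hj hji.symm]; simp]
    rw [inner_smul_left, inner_smul_right, real_inner_self_eq_norm_sq]
    simp only [conj_trivial]; ring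
  rw [norm_sub_sq_real, h1, inner_sum]
  have h2 : ∀ i ∈ P, 2 * ⟪w, c i • y i⟫ - c i ^ 2 * ‖y i‖ ^ 2 ≤ ⟪w, y i⟫ ^ 2 / ‖y i‖ ^ 2 := by
    intro i _
    rw [inner_smul_right]
    by_cases h : y i = 0
    · simp [h]
    · have hpos : 0 < ‖y i‖ ^ 2 := by positivity
      rw [le_div_iff₀ hpos]
      nlinarith [sq_nonneg (⟪w, y i⟫ - c i * ‖y i‖ ^ 2)]
  have h3 := Finset.sum_le_sum h2
  rw [Finset.sum_sub_distrib, ← Finset.mul_sum] at h3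
  linarith

theorem IsLasserre.norm_sq_sub_residual_le {V : Type*} [Fintype V] [DecidableEq V] {R d : ℕ}
    {x : Finset V → (V → Bool) → EuclideanSpace ℝ (Fin d)} (hx : IsLasserre V R d x)
    {S : Finset V} (hS : S.card ≤ R) (u v : V) :
    ‖xVec x u - xVec x v‖ ^ 2 - ‖(xVec x u - xVec x v) -
        (Submodule.span ℝ (xVec x '' S)).starProjection (xVec x u - xVec x v)‖ ^ 2
      ≤ ∑ A ∈ S.powerset, |⟪xVec x u, labVec x S A⟫ - ⟪xVec x v, labVec x S A⟫| := by
  have hle : Submodule.span ℝ (xVec x '' S) ≤ Submodule.span ℝ (labVec x S '' S.powerset) := by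
    rw [Submodule.span_le]
    rintro _ ⟨w, hw, rfl⟩
    exact hx.xVec_mem_span_labVec (by omega) (by simpa using hw)
  refine (norm_sq_sub_norm_sub_sq_le S.powerset (labVec x S) (fun A hA B hB hAB =>
    hx.inner_labVec_eq_zero (by omega) (Finset.mem_powerset.1 hA) (Finset.mem_powerset.1 hB) hAB)
    _ _ (hle (Submodule.starProjection_apply_mem _ _))).trans ?_
  refine Finset.sum_le_sum fun A _ => ?_
  rw [← inner_sub_left]
  set g := ⟪xVec x u - xVec x v, labVec x S A⟫ with hg
  have hgle : |g| ≤ ‖labVec x S A‖ ^ 2 := by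
    rw [hg, inner_sub_left, abs_le]
    have h1 := hx.inner_xVec_labVec_le hS A u
    have h2 := hx.inner_xVec_labVec_le hS A v
    have h3 := hx.inner_xVec_labVec_nonneg hS A u
    have h4 := hx.inner_xVec_labVec_nonneg hS A v
    constructor <;> linarith
  refine div_le_of_le_mul₀ (sq_nonneg _) (abs_nonneg _) ?_
  rw [← sq_abs, sq]
  exact mul_le_mul_of_nonneg_left hgle (abs_nonneg _)

theorem integral_abs_threshold_sub (a b : ℝ) :
    MeasureTheory.Integrable (fun τ : ℝ =>
        |(if τ < a then (1 : ℝ) else 0) - (if τ < b then (1 : ℝ) else 0)|) ∧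
      ∫ τ : ℝ, |(if τ < a then (1 : ℝ) else 0) - (if τ < b then (1 : ℝ) else 0)| = |a - b| := by
  have h : (fun τ : ℝ => |(if τ < a then (1 : ℝ) else 0) - (if τ < b then (1 : ℝ) else 0)|)
      = (Set.Ico (min a b) (max a b)).indicator fun _ => (1 : ℝ) := by
    ext τ
    simp only [Set.indicator_apply, Set.mem_Ico, min_le_iff, lt_max_iff]
    by_cases h1 : τ < a <;> by_cases h2 : τ < b <;> simp [h1, h2, not_le.2, not_lt.1]
  rw [h]
  refine ⟨(MeasureTheory.integrable_indicator_iff measurableSet_Ico).2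
    (MeasureTheory.integrableOn_const (by simp)), ?_⟩
  rw [MeasureTheory.integral_indicator_const _ measurableSet_Ico]
  simp [MeasureTheory.measureReal_def, max_sub_min_eq_abs, abs_sub_comm]

/-- A linear cut inequality extends to the `ℓ₁` metric of any function on the vertices. -/
theorem sum_mul_abs_sub_nonneg {V : Type*} [Fintype V] [DecidableEq V] (W : V → V → ℝ)
    (hW : ∀ T : Finset V, 0 ≤ ∑ u, ∑ v, W u v *
      |(if u ∈ T then (1 : ℝ) else 0) - (if v ∈ T then (1 : ℝ) else 0)|) (p : V → ℝ) :
    0 ≤ ∑ u, ∑ v, W u v * |p u - p v| := by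
  have h : ∑ u, ∑ v, W u v * |p u - p v| = ∫ τ : ℝ, ∑ u, ∑ v, W u v *
      |(if τ < p u then (1 : ℝ) else 0) - (if τ < p v then (1 : ℝ) else 0)| := by
    have hi := fun u v => (integral_abs_threshold_sub (p u) (p v)).1.const_mul (W u v)
    rw [MeasureTheory.integral_finsetSum _ fun u _ =>
      MeasureTheory.integrable_finsetSum _ fun v _ => hi u v]
    refine Finset.sum_congr rfl fun u _ => ?_
    rw [MeasureTheory.integral_finsetSum _ fun v _ => hi u v]
    refine Finset.sum_congr rfl fun v _ => ?_
    rw [MeasureTheory.integral_const_mul, (integral_abs_threshold_sub (p u) (p v)).2]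
  rw [h]
  refine MeasureTheory.integral_nonneg fun τ => ?_
  simpa using hW (Finset.univ.filter fun u => τ < p u)

theorem mul_sum_abs_sub_le {V : Type*} [Fintype V] [DecidableEq V] (C D : V → V → ℝ) (ρ : ℝ)
    (h : ∀ T, ρ * cutVal D T ≤ cutVal C T) (p : V → ℝ) :
    ρ * ∑ u, ∑ v, D u v * |p u - p v| ≤ ∑ u, ∑ v, C u v * |p u - p v| := by
  have h1 : ∀ q : V → V → ℝ, ∑ u, ∑ v, (C u v - ρ * D u v) * q u v
      = ∑ u, ∑ v, C u v * q u v - ρ * ∑ u, ∑ v, D u v * q u v := by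
    intro q
    simp only [Finset.mul_sum, ← Finset.sum_sub_distrib]
    exact Finset.sum_congr rfl fun u _ => Finset.sum_congr rfl fun v _ => by ring
  have h2 := sum_mul_abs_sub_nonneg (fun u v => C u v - ρ * D u v) (fun T => by
    rw [h1 fun u v => |(if u ∈ T then (1 : ℝ) else 0) - (if v ∈ T then (1 : ℝ) else 0)|]
    have := h T
    simp only [cutVal] at this
    linarith) p
  rw [h1 fun u v => |p u - p v|] at h2
  linarith

/-- A positive lower bound on the sparsity of every cut gives a positive spectral lower bound. -/
theorem exists_pos_mul_sum_sq_le {V : Type*} [Fintype V] [DecidableEq V] (C D : V → V → ℝ)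
    (hC : ∀ u v, 0 ≤ C u v) (hD : ∀ u v, 0 ≤ D u v) (ρ : ℝ) (hρ : 0 < ρ)
    (h : ∀ T, ρ * cutVal D T ≤ cutVal C T) :
    ∃ c > 0, ∀ w : V → ℝ,
      c * ∑ u, ∑ v, D u v * (w u - w v) ^ 2 ≤ ∑ u, ∑ v, C u v * (w u - w v) ^ 2 := by
  obtain ⟨δ, hδ, hδD⟩ : ∃ δ > 0, ∀ e : V × V, δ * D e.1 e.2 ≤ D e.1 e.2 ^ 2 := by
    by_cases hne : (Finset.univ.filter fun e : V × V => 0 < D e.1 e.2).Nonempty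
    · obtain ⟨e₀, he₀, hmin⟩ := Finset.exists_min_image _ (fun e : V × V => D e.1 e.2) hne
      refine ⟨D e₀.1 e₀.2, by simpa using he₀, fun e => ?_⟩
      rcases (hD e.1 e.2).eq_or_lt with h0 | h0
      · simp [← h0]
      · rw [sq]
        exact mul_le_mul_of_nonneg_right (hmin e (by simpa using h0)) h0.le
    · refine ⟨1, one_pos, fun e => ?_⟩
      have : D e.1 e.2 = 0 := by
        by_contra h0
        exact hne ⟨e, by simpa using lt_of_le_of_ne (hD _ _) (Ne.symm h0)⟩
      simp [this]
  set s := ∑ e : V × V, C e.1 e.2 with hs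
  have hs0 : 0 ≤ s := Finset.sum_nonneg fun e _ => hC _ _
  have hs1 : 0 < s + 1 := by linarith
  refine ⟨ρ ^ 2 * δ / (s + 1), by positivity, fun w => ?_⟩
  have h1 := mul_sum_abs_sub_le C D ρ h w
  simp only [← Fintype.sum_prod_type' (f := fun u v => C u v * |w u - w v|),
    ← Fintype.sum_prod_type' (f := fun u v => D u v * |w u - w v|),
    ← Fintype.sum_prod_type' (f := fun u v => C u v * (w u - w v) ^ 2),
    ← Fintype.sum_prod_type' (f := fun u v => D u v * (w u - w v) ^ 2)] at h1 ⊢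
  have h2 : (∑ e : V × V, C e.1 e.2 * |w e.1 - w e.2|) ^ 2 ≤
      s * ∑ e : V × V, C e.1 e.2 * (w e.1 - w e.2) ^ 2 := by
    refine Finset.sum_sq_le_sum_mul_sum_of_sq_le_mul _ (fun e _ => hC _ _)
      (fun e _ => mul_nonneg (hC _ _) (sq_nonneg _)) fun e _ => le_of_eq ?_
    rw [mul_pow, sq_abs]; ring
  have h3 : δ * ∑ e : V × V, D e.1 e.2 * (w e.1 - w e.2) ^ 2 ≤
      (∑ e : V × V, D e.1 e.2 * |w e.1 - w e.2|) ^ 2 := by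
    refine le_trans ?_ (Finset.sum_sq_le_sq_sum_of_nonneg fun e _ =>
      mul_nonneg (hD _ _) (abs_nonneg _))
    rw [Finset.mul_sum]
    refine Finset.sum_le_sum fun e _ => ?_
    rw [mul_pow, sq_abs, ← mul_assoc]
    exact mul_le_mul_of_nonneg_right (hδD e) (sq_nonneg _)
  have h4 : 0 ≤ ∑ e : V × V, D e.1 e.2 * |w e.1 - w e.2| :=
    Finset.sum_nonneg fun e _ => mul_nonneg (hD _ _) (abs_nonneg _)
  have h5 : 0 ≤ ∑ e : V × V, C e.1 e.2 * (w e.1 - w e.2) ^ 2 :=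
    Finset.sum_nonneg fun e _ => mul_nonneg (hC _ _) (sq_nonneg _)
  rw [div_mul_eq_mul_div, div_le_iff₀ hs1]
  have h6 := pow_le_pow_left₀ (mul_nonneg hρ.le h4) h1 2
  rw [mul_pow] at h6
  have h7 := mul_le_mul_of_nonneg_left h3 (sq_nonneg ρ)
  nlinarith

theorem cutVal_nonneg {V : Type*} [Fintype V] [DecidableEq V] (W : V → V → ℝ)
    (hW : ∀ u v, 0 ≤ W u v) (T : Finset V) : 0 ≤ cutVal W T :=
  div_nonneg (Finset.sum_nonneg fun u _ => Finset.sum_nonneg fun v _ =>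
    mul_nonneg (hW u v) (abs_nonneg _)) zero_le_two

theorem exists_cutVal_pos {V : Type*} [Fintype V] [DecidableEq V] {d : ℕ} (W : V → V → ℝ)
    (hW : ∀ u v, 0 ≤ W u v) (x : Finset V → (V → Bool) → EuclideanSpace ℝ (Fin d))
    (h : 0 < edgeSum W x) : ∃ T, 0 < cutVal W T := by
  obtain ⟨u, -, hu⟩ := Finset.exists_lt_of_sum_lt
    (s := Finset.univ) (f := fun _ : V => (0 : ℝ)) (by
      simp only [edgeSum] at h
      simpa using h)
  obtain ⟨v, -, hv⟩ := Finset.exists_lt_of_sum_lt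
    (s := Finset.univ) (f := fun _ : V => (0 : ℝ)) (by simpa using hu)
  have huv : v ≠ u := by rintro rfl; simp at hv
  refine ⟨{u}, div_pos (Finset.sum_pos' (fun a _ => Finset.sum_nonneg fun b _ =>
    mul_nonneg (hW a b) (abs_nonneg _)) ⟨u, Finset.mem_univ _, Finset.sum_pos' (fun b _ =>
    mul_nonneg (hW u b) (abs_nonneg _)) ⟨v, Finset.mem_univ _, ?_⟩⟩) two_pos⟩
  simpa [huv] using pos_of_mul_pos_left hv (sq_nonneg _)

/-- Main rounding guarantee: for edge weights `C, D` with Laplacians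
`L_C, L_D`, a positive integer `r` with `r + 1 ≤ rank(L_D)`, `ε > 0`,
`r' = ⌈r/ε⌉ + r − 1`, and any Lasserre solution `x ∈ Lasserre_{2r'+2}(V)` with positive
demand objective, if `(1+ε)·Φ^SDP/λ_{r+1}(L_C, L_D) < 1` then there is a cut `T` with
`D(T) > 0` and `Φ_T ≤ Φ^SDP · (1 − (1+ε)·Φ^SDP/λ_{r+1}(L_C, L_D))⁻¹`. -/
theorem stmt16 {V : Type*} [Fintype V] [DecidableEq V] (C D : V → V → ℝ)
    (hCsymm : ∀ u v, C u v = C v u) (hCnonneg : ∀ u v, 0 ≤ C u v)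
    (hCdiag : ∀ u, C u u = 0)
    (hDsymm : ∀ u v, D u v = D v u) (hDnonneg : ∀ u v, 0 ≤ D u v)
    (hDdiag : ∀ u, D u u = 0)
    (r : ℕ) (hr : 0 < r) (ε : ℝ) (hε : 0 < ε)
    (hrank : r + 1 ≤ (lapM D).rank)
    (d : ℕ) (x : Finset V → (V → Bool) → EuclideanSpace ℝ (Fin d))
    (hx : IsLasserre V (2 * (⌈(r : ℝ) / ε⌉₊ + r - 1) + 2) d x)
    (hD : 0 < edgeSum D x)
    (hgap : (1 + ε) * (edgeSum C x / edgeSum D x) /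
        genEig (lapM C) (lapM D) (r + 1) < 1) :
    ∃ T : Finset V, 0 < cutVal D T ∧
      cutVal C T / cutVal D T
        ≤ (edgeSum C x / edgeSum D x) *
          (1 - (1 + ε) * (edgeSum C x / edgeSum D x) /
            genEig (lapM C) (lapM D) (r + 1))⁻¹ := by
  set lam := genEig (lapM C) (lapM D) (r + 1) with hlam
  obtain ⟨T₀, hT₀⟩ := exists_cutVal_pos D hDnonneg x hD
  obtain ⟨T, hT, hmin⟩ := Finset.exists_min_image
    (Finset.univ.filter fun T : Finset V => 0 < cutVal D T)
    (fun T => cutVal C T / cutVal D T) ⟨T₀, by simpa using hT₀⟩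
  have hTpos : 0 < cutVal D T := by simpa using hT
  refine ⟨T, hTpos, ?_⟩
  set ρ := cutVal C T / cutVal D T with hρdef
  have hcut : ∀ T', ρ * cutVal D T' ≤ cutVal C T' := by
    intro T'
    rcases (cutVal_nonneg D hDnonneg T').eq_or_lt with h | h
    · rw [← h, mul_zero]; exact cutVal_nonneg C hCnonneg T'
    · exact (le_div_iff₀ h).1 (hmin T' (by simpa using h))
  have hC0 : 0 ≤ edgeSum C x := div_nonneg (Finset.sum_nonneg fun u _ =>
    Finset.sum_nonneg fun v _ => mul_nonneg (hCnonneg u v) (sq_nonneg _)) zero_le_two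
  have hgap' : 0 < 1 - (1 + ε) * (edgeSum C x / edgeSum D x) / lam := by linarith
  rcases (show 0 ≤ ρ from div_nonneg (cutVal_nonneg C hCnonneg T) hTpos.le).eq_or_lt with h0 | hρ
  · rw [← h0]
    exact mul_nonneg (div_nonneg hC0 hD.le) (inv_nonneg.2 hgap'.le)
  obtain ⟨c, hc, hcw⟩ := exists_pos_mul_sum_sq_le C D hCnonneg hDnonneg ρ hρ hcut
  have hlampos : 0 < lam := hc.trans_le <| le_genEig _ _
    (dotProduct_lapM_mulVec_nonneg C hCsymm hCnonneg)
    (dotProduct_lapM_mulVec_pos D hDsymm hDnonneg) r hrank c fun w => by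
      rw [dotProduct_lapM_mulVec C hCsymm, dotProduct_lapM_mulVec D hDsymm]
      linarith [hcw w]
  have hrpos : (0 : ℝ) < r := by exact_mod_cast hr
  have hkpos : 0 < ⌈(r : ℝ) / ε⌉₊ := Nat.ceil_pos.2 (div_pos hrpos hε)
  obtain ⟨S, hS, hres⟩ := exists_seeds_genEig_mul_residual_le C D hCsymm hCnonneg hDsymm hDnonneg
    r ⌈(r : ℝ) / ε⌉₊ (⌈(r : ℝ) / ε⌉₊ + r - 1) (by omega) (xVec x) hlampos
  rw [← hlam] at hres
  have hrk : (r : ℝ) ≤ ε * ⌈(r : ℝ) / ε⌉₊ := by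
    rw [← div_le_iff₀' hε]; exact Nat.le_ceil _
  have hkpos' : (0 : ℝ) < ⌈(r : ℝ) / ε⌉₊ := by exact_mod_cast hkpos
  set k : ℝ := (⌈(r : ℝ) / ε⌉₊ : ℝ) with hk
  set res := ∑ u, ∑ v, D u v * ‖(xVec x u - xVec x v) -
    (Submodule.span ℝ (xVec x '' S)).starProjection (xVec x u - xVec x v)‖ ^ 2 with hresdef
  have hEC : ∑ u, ∑ v, C u v * ‖xVec x u - xVec x v‖ ^ 2 = 2 * edgeSum C x := by
    rw [edgeSum]; ring
  have hED : ∑ u, ∑ v, D u v * ‖xVec x u - xVec x v‖ ^ 2 = 2 * edgeSum D x := by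
    rw [edgeSum]; ring
  rw [hEC] at hres
  have hres' : lam * res ≤ (1 + ε) * (2 * edgeSum C x) := by
    refine le_of_mul_le_mul_left ?_ hkpos'
    calc k * (lam * res) = lam * (k * res) := by ring
      _ ≤ (k + r) * (2 * edgeSum C x) := hres
      _ ≤ (k + ε * k) * (2 * edgeSum C x) := by gcongr
      _ = _ := by ring
  have hswap : ∀ W : V → V → ℝ, ∑ A ∈ S.powerset, ∑ u, ∑ v, W u v *
      |⟪xVec x u, labVec x S A⟫ - ⟪xVec x v, labVec x S A⟫| = ∑ u, ∑ v, W u v *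
      ∑ A ∈ S.powerset, |⟪xVec x u, labVec x S A⟫ - ⟪xVec x v, labVec x S A⟫| := by
    intro W
    rw [Finset.sum_comm]
    refine Finset.sum_congr rfl fun u _ => ?_
    rw [Finset.sum_comm]
    exact Finset.sum_congr rfl fun v _ => (Finset.mul_sum _ _ _).symm
  have hround := Finset.sum_le_sum fun A (_ : A ∈ S.powerset) =>
    mul_sum_abs_sub_le C D ρ hcut fun u => ⟪xVec x u, labVec x S A⟫
  rw [← Finset.mul_sum, hswap, hswap] at hround
  have hcost : ∑ u, ∑ v, C u v * ∑ A ∈ S.powerset,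
      |⟪xVec x u, labVec x S A⟫ - ⟪xVec x v, labVec x S A⟫| ≤ 2 * edgeSum C x := by
    rw [← hEC]
    exact Finset.sum_le_sum fun u _ => Finset.sum_le_sum fun v _ =>
      mul_le_mul_of_nonneg_left (hx.sum_abs_inner_le (by omega) u v) (hCnonneg u v)
  have hdemand : 2 * edgeSum D x - res ≤ ∑ u, ∑ v, D u v * ∑ A ∈ S.powerset,
      |⟪xVec x u, labVec x S A⟫ - ⟪xVec x v, labVec x S A⟫| := by
    rw [← hED, hresdef]
    simp only [← Finset.sum_sub_distrib, ← mul_sub]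
    exact Finset.sum_le_sum fun u _ => Finset.sum_le_sum fun v _ =>
      mul_le_mul_of_nonneg_left (hx.norm_sq_sub_residual_le (by omega) u v) (hDnonneg u v)
  have hfinal : ρ * (2 * edgeSum D x - res) ≤ 2 * edgeSum C x :=
    (mul_le_mul_of_nonneg_left hdemand hρ.le).trans (hround.trans hcost)
  have hresle : res ≤ (1 + ε) * (2 * edgeSum C x) / lam := (le_div_iff₀' hlampos).2 hres'
  rw [← div_eq_mul_inv, le_div_iff₀ hgap', le_div_iff₀ hD]
  have hscale : ρ * (1 - (1 + ε) * (edgeSum C x / edgeSum D x) / lam) * edgeSum D x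
      = ρ * (2 * edgeSum D x - (1 + ε) * (2 * edgeSum C x) / lam) / 2 := by
    field_simp
  rw [hscale]
  have := mul_le_mul_of_nonneg_left (sub_le_sub_left hresle (2 * edgeSum D x)) hρ.le
  linarith
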